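/- Let C = ⟨(b(x) | 0), (ℓ(x) | a(x))⟩ be a Z₂-double cyclic code with b(x) | x^r−1, a(x) | x^s−1, and a(x) generating C_s. Then the Z₂[x]-submodule generated by (0 | (x^s−1)/a*(x)) is contained in the dual code C^⊥. -/

import Mathlib

open Polynomial

noncomputable section

/-- The polynomial ring `Z₂[x]`. -/
abbrev Z2P : Type := Polynomial (ZMod 2)

/-- The quotient ring `Z₂[x]/(x^n - 1)`. -/
abbrev Rq (n : ℕ) : Type := Z2P ⧸ Ideal.span {(X : Z2P) ^ n - 1}

/-- The canonical projection `Z₂[x] → Z₂[x]/(x^n - 1)`. -/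
def mkQ (n : ℕ) : Z2P →+* Rq n := Ideal.Quotient.mk _

/-- The element of `Z₂[x]/(x^n − 1)` associated to a vector `v ∈ Z₂^n` via coefficients. -/
def ofVec (n : ℕ) (v : Fin n → ZMod 2) : Rq n :=
  mkQ n (∑ i : Fin n, Polynomial.C (v i) * (X : Z2P) ^ (i : ℕ))

/-- The dual code `C^⊥` of a `Z₂`-double cyclic code `C ⊆ R_{r,s}`, computed with respect to
the standard inner product on `Z₂^{r+s}` under the coefficient identification
`R_{r,s} ≅ Z₂^r × Z₂^s`. -/
def dualCode (r s : ℕ) (C : Submodule Z2P (Rq r × Rq s)) : Set (Rq r × Rq s) :=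
  {c | ∃ w : (Fin r → ZMod 2) × (Fin s → ZMod 2),
        (ofVec r w.1, ofVec s w.2) = c ∧
        ∀ u : (Fin r → ZMod 2) × (Fin s → ZMod 2),
          (ofVec r u.1, ofVec s u.2) ∈ C →
          (∑ i, u.1 i * w.1 i) + (∑ j, u.2 j * w.2 j) = 0}

lemma mkQ_eq_zero_iff {n : ℕ} {p : Z2P} : mkQ n p = 0 ↔ (X : Z2P) ^ n - 1 ∣ p := by
  rw [mkQ, Ideal.Quotient.eq_zero_iff_mem, Ideal.mem_span_singleton]

lemma mkQ_X_pow_self (n : ℕ) : mkQ n X ^ n = 1 := by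
  rw [← sub_eq_zero, ← map_pow, ← map_one (mkQ n), ← map_sub, mkQ_eq_zero_iff]

lemma smul_mkQ (n : ℕ) (p q : Z2P) : p • mkQ n q = mkQ n (p * q) := rfl

lemma X_pow_sub_one_monic {n : ℕ} (hn : 0 < n) : ((X : Z2P) ^ n - 1).Monic := by
  simpa using monic_X_pow_sub_C (1 : ZMod 2) hn.ne'

/-- Every class modulo `x^n - 1` is represented by a vector of coefficients. -/
lemma ofVec_surjective {n : ℕ} (hn : 0 < n) : Function.Surjective (ofVec n) := by
  intro c
  obtain ⟨p, rfl⟩ := Ideal.Quotient.mk_surjective c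
  have hmon := X_pow_sub_one_monic hn
  have hdeg : (p %ₘ ((X : Z2P) ^ n - 1)).degree < (n : ℕ) := by
    refine (degree_modByMonic_lt p hmon).trans_le ?_
    simpa using (degree_X_pow_sub_C hn (1 : ZMod 2)).le
  refine ⟨fun i => (p %ₘ ((X : Z2P) ^ n - 1)).coeff i, ?_⟩
  have hsum : (∑ i : Fin n, Polynomial.C ((p %ₘ ((X : Z2P) ^ n - 1)).coeff i) *
      (X : Z2P) ^ (i : ℕ)) = p %ₘ ((X : Z2P) ^ n - 1) := by
    rw [Fin.sum_univ_eq_sum_range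
      (fun i => Polynomial.C ((p %ₘ ((X : Z2P) ^ n - 1)).coeff i) * (X : Z2P) ^ i) n]
    by_cases h0 : p %ₘ ((X : Z2P) ^ n - 1) = 0
    · simp [h0]
    · exact (as_sum_range_C_mul_X_pow' _ ((natDegree_lt_iff_degree_lt h0).2 hdeg)).symm
  change mkQ n _ = mkQ n p
  rw [hsum, ← sub_eq_zero, ← map_sub, mkQ_eq_zero_iff]
  refine ⟨-(p /ₘ ((X : Z2P) ^ n - 1)), ?_⟩
  linear_combination modByMonic_add_div p ((X : Z2P) ^ n - 1)

/-- The constant coefficient of the reduction of a polynomial modulo `x^n - 1`. -/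
def cyclicConstCoeff (n : ℕ) : Z2P →ₗ[ZMod 2] ZMod 2 :=
  Polynomial.lsum fun k => if n ∣ k then LinearMap.id else 0

lemma cyclicConstCoeff_C_mul_X_pow (n k : ℕ) (c : ZMod 2) :
    cyclicConstCoeff n (Polynomial.C c * X ^ k) = if n ∣ k then c else 0 := by
  rw [cyclicConstCoeff, Polynomial.lsum_apply, C_mul_X_pow_eq_monomial,
    sum_monomial_index _ _ (LinearMap.map_zero _)]
  split_ifs <;> rfl

lemma cyclicConstCoeff_eq_zero_of_dvd {n : ℕ} {p : Z2P} (h : (X : Z2P) ^ n - 1 ∣ p) :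
    cyclicConstCoeff n p = 0 := by
  obtain ⟨q, rfl⟩ := h
  induction q using Polynomial.induction_on' with
  | add p q hp hq => rw [mul_add, map_add, hp, hq, add_zero]
  | monomial k c =>
    have h : ((X : Z2P) ^ n - 1) * monomial k c
        = Polynomial.C c * X ^ (k + n) - Polynomial.C c * X ^ k := by
      rw [← C_mul_X_pow_eq_monomial]; ring
    rw [h, map_sub, cyclicConstCoeff_C_mul_X_pow, cyclicConstCoeff_C_mul_X_pow]
    simp

/-- The standard inner product is the cyclic constant coefficient of `u(x) v(x⁻¹)`. -/
lemma cyclicConstCoeff_mul_comp {n : ℕ} (u v : Fin n → ZMod 2) :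
    cyclicConstCoeff n ((∑ i, Polynomial.C (u i) * (X : Z2P) ^ (i : ℕ)) *
      (∑ j, Polynomial.C (v j) * (X : Z2P) ^ (j : ℕ)).comp (X ^ (n - 1))) = ∑ i, u i * v i := by
  have hdvd (i j : Fin n) : n ∣ (i : ℕ) + (n - 1) * j ↔ i = j := by
    obtain ⟨m, rfl⟩ : ∃ m, n = m + 1 := ⟨n - 1, by have := i.pos; omega⟩
    rw [Nat.add_sub_cancel, ← (Nat.modEq_zero_iff_dvd), Fin.ext_iff]
    have h0 : (m + 1) * (j : ℕ) ≡ 0 [MOD m + 1] :=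
      Nat.modEq_zero_iff_dvd.2 (dvd_mul_right _ _)
    constructor
    · intro h
      have h1 : (i : ℕ) + m * j ≡ j + m * j [MOD m + 1] :=
        by
        convert h.trans h0.symm using 1
        ring
      exact (Nat.ModEq.add_right_cancel' _ h1).eq_of_lt_of_lt i.isLt j.isLt
    · intro h
      rw [h]
      convert h0 using 1
      ring
  have hterm (i j : Fin n) : Polynomial.C (u i) * (X : Z2P) ^ (i : ℕ) *
      (Polynomial.C (v j) * (X ^ (n - 1)) ^ (j : ℕ)) =
      Polynomial.C (u i * v j) * X ^ ((i : ℕ) + (n - 1) * j) := by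
    rw [C_mul, pow_add, pow_mul]; ring
  simp only [Polynomial.sum_comp, mul_comp, C_comp, pow_comp, X_comp, Finset.sum_mul_sum, hterm,
    map_sum, cyclicConstCoeff_C_mul_X_pow, hdvd]
  simp

lemma reverse_X_pow_sub_one (n : ℕ) :
    ((X : Z2P) ^ n - 1).reverse = X ^ n - 1 := by
  have hdeg : ((X : Z2P) ^ n - 1).natDegree = n := by
    simpa using natDegree_X_pow_sub_C (n := n) (r := (1 : ZMod 2))
  have h1 : reflect n (1 : Z2P) = X ^ n := by simp
  have hX : reflect n ((X : Z2P) ^ n) = 1 := by rw [← h1, reflect_reflect]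
  rw [reverse, hdeg, reflect_sub, hX, h1, ← neg_sub, CharTwo.neg_eq]

/-- If `a h = x^n - 1`, then `(x^n - 1) / a*` is the reciprocal polynomial of `h`. -/
lemma X_pow_sub_one_div_reverse {n : ℕ} (hn : 0 < n) {a h : Z2P}
    (hah : (X : Z2P) ^ n - 1 = a * h) : ((X : Z2P) ^ n - 1) / a.reverse = h.reverse := by
  have hne := (X_pow_sub_one_monic hn).ne_zero
  have ha : a.reverse ≠ 0 := by
    rw [Ne, reverse_eq_zero]
    rintro rfl
    exact hne (by rw [hah, zero_mul])
  rw [← reverse_X_pow_sub_one n, hah, reverse_mul_of_domain, mul_div_cancel_left₀ _ ha]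

lemma X_pow_sub_one_dvd_comp (n m : ℕ) {p : Z2P} (h : (X : Z2P) ^ n - 1 ∣ p) :
    (X : Z2P) ^ n - 1 ∣ p.comp (X ^ m) := by
  obtain ⟨q, rfl⟩ := h
  rw [mul_comp, sub_comp, pow_comp, X_comp, one_comp, ← pow_mul, mul_comm m, pow_mul]
  exact (sub_one_dvd_pow_sub_one _ m).mul_right _

/-- Modulo `x^n - 1`, `h*(x⁻¹)` is a unit multiple of `h`, so it is annihilated by `a`. -/
lemma X_pow_sub_one_dvd_mul_reverse_comp {n : ℕ} (hn : 0 < n) {a h : Z2P}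
    (hah : (X : Z2P) ^ n - 1 = a * h) :
    (X : Z2P) ^ n - 1 ∣ a * h.reverse.comp (X ^ (n - 1)) := by
  have hinv : mkQ n X ^ (n - 1) * mkQ n X = 1 := by
    rw [← pow_succ, Nat.sub_add_cancel hn, mkQ_X_pow_self]
  let _ : Invertible (mkQ n X) := invertibleOfLeftInverse _ _ hinv
  have heval (p : Z2P) : mkQ n p = eval₂ ((mkQ n).comp Polynomial.C) (mkQ n X) p := by
    rw [← hom_eval₂, eval₂_C_X]
  have hrev : mkQ n (h.reverse.comp (X ^ (n - 1))) * mkQ n X ^ h.natDegree = mkQ n h := by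
    rw [heval h, ← eval₂_reverse_mul_pow, comp, hom_eval₂, map_pow]
    rfl
  have hunit : IsUnit (mkQ n X ^ h.natDegree) := (isUnit_of_invertible _).pow _
  rw [← mkQ_eq_zero_iff, map_mul, ← hunit.mul_left_eq_zero, mul_assoc, hrev, ← map_mul, ← hah,
    mkQ_eq_zero_iff]

/-- Let `C = ⟨(b | 0), (ℓ | a)⟩` with `b ∣ x^r−1`, `a ∣ x^s−1` and `a` generating `C_s`.
Then `⟨(0 | (x^s−1)/a*)⟩ ⊆ C^⊥`, where `a* = reverse a` is the reciprocal polynomial. -/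
theorem stmt14 (r s : ℕ) (hr : 0 < r) (hs : 0 < s) (b l a : Z2P)
    (C : Submodule Z2P (Rq r × Rq s))
    (hCdef : C = Submodule.span Z2P {((mkQ r b, 0) : Rq r × Rq s), (mkQ r l, mkQ s a)})
    (hb : b ∣ (X : Z2P) ^ r - 1) (ha : a ∣ (X : Z2P) ^ s - 1)
    (hCs : Submodule.map (LinearMap.snd Z2P (Rq r) (Rq s)) C =
      Submodule.span Z2P {mkQ s a}) :
    (Submodule.span Z2P
        {(((0 : Rq r), mkQ s (((X : Z2P) ^ s - 1) / a.reverse)) : Rq r × Rq s)} :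
      Set (Rq r × Rq s)) ⊆ dualCode r s C := by
  obtain ⟨h, hah⟩ := ha
  rw [X_pow_sub_one_div_reverse hs hah]
  intro c hc
  obtain ⟨f, rfl⟩ := Submodule.mem_span_singleton.1 hc
  obtain ⟨w, hw⟩ := ofVec_surjective hs (f • mkQ s h.reverse)
  refine ⟨(0, w), Prod.ext ?_ ?_, ?_⟩
  · simp [ofVec]
  · exact hw
  rintro ⟨u, v⟩ huv
  have hv : ofVec s v ∈ Submodule.span Z2P {mkQ s a} := hCs ▸ Submodule.mem_map_of_mem huv
  obtain ⟨g, hg⟩ := Submodule.mem_span_singleton.1 hv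
  rw [smul_mkQ, ofVec, eq_comm, ← sub_eq_zero, ← map_sub, mkQ_eq_zero_iff] at hg
  rw [smul_mkQ, ofVec, ← sub_eq_zero, ← map_sub, mkQ_eq_zero_iff] at hw
  have hw' := X_pow_sub_one_dvd_comp s (s - 1) hw
  rw [sub_comp, mul_comp] at hw'
  have hah' := X_pow_sub_one_dvd_mul_reverse_comp hs hah
  have hvw := cyclicConstCoeff_mul_comp v w
  rw [cyclicConstCoeff_eq_zero_of_dvd] at hvw
  · simp [← hvw]
  set W := (∑ j, Polynomial.C (w j) * (X : Z2P) ^ (j : ℕ)).comp (X ^ (s - 1))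
  set V := ∑ j, Polynomial.C (v j) * (X : Z2P) ^ (j : ℕ)
  have hsplit : V * W = (V - g * a) * W
      + g * a * (W - f.comp (X ^ (s - 1)) * h.reverse.comp (X ^ (s - 1)))
      + g * f.comp (X ^ (s - 1)) * (a * h.reverse.comp (X ^ (s - 1))) := by ring
  rw [hsplit]
  exact dvd_add (dvd_add (hg.mul_right _) (hw'.mul_left _)) (hah'.mul_left _)
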